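/- arXiv:1409.2308 — 5 statements merged into one kernel-verified Lean document; each statement's English description precedes it below -/
import Mathlib

section
/- (Locally testable languages theorem) Let A be a finite alphabet and L a language over A. Then L is locally testable if and only if the syntactic congruence ≈_L has finitely many equivalence classes and the syntactic semigroup of L is a local semilattice: for all nonempty words e, x, y such that e·e ≈_L e, one has (exe)·(exe) ≈_L exe and (exe)·(eye) ≈_L (eye)·(exe), where juxtaposition denotes concatenation of words. -/
/-- The syntactic congruence of a language `L`: `x ≈_L y` iff for all words `u, v`,
`u ++ x ++ v ∈ L ↔ u ++ y ++ v ∈ L`. -/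
def SynRel {A : Type} (L : Set (List A)) (x y : List A) : Prop :=
  ∀ u v : List A, (u ++ x ++ v ∈ L ↔ u ++ y ++ v ∈ L)

/-- The syntactic congruence as a setoid on words. -/
def synSetoid {A : Type} (L : Set (List A)) : Setoid (List A) where
  r := SynRel L
  iseqv := ⟨fun _ _ _ => Iff.rfl, fun h u v => (h u v).symm,
    fun h h' u v => (h u v).trans (h' u v)⟩

/-- A language `L` is locally testable if for some `k ≥ 1`, membership of a word of length
at least `k` depends only on its prefix of length `k`, its suffix of length `k`, and its set
of factors (contiguous subwords) of length `k`; membership of words of length `< k` is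
unconstrained. -/
def LocallyTestable {A : Type} (L : Set (List A)) : Prop :=
  ∃ k : ℕ, 1 ≤ k ∧
    ∀ u v : List A, k ≤ u.length → k ≤ v.length →
      u.take k = v.take k →
      u.drop (u.length - k) = v.drop (v.length - k) →
      {w : List A | w.length = k ∧ w.IsInfix u} = {w : List A | w.length = k ∧ w.IsInfix v} →
      (u ∈ L ↔ v ∈ L)

namespace LocalTestability

section Paths

variable {V A : Type} (δ : V → A → V)

/-- The edges, i.e. pairs of a state and a letter, traversed when reading `x` from `w`. -/
def edges (w : V) (x : List A) : Set (V × A) :=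
  {g | ∃ p r, x = p ++ g.2 :: r ∧ p.foldl δ w = g.1}

theorem edges_append (w : V) (x y : List A) :
    edges δ w (x ++ y) = edges δ w x ∪ edges δ (x.foldl δ w) y := by
  ext ⟨v, a⟩
  constructor
  · rintro ⟨p, r, h, hp⟩
    rcases List.append_eq_append_iff.1 h with ⟨s, rfl, rfl⟩ | ⟨s, rfl, h'⟩
    · exact Or.inr ⟨s, r, rfl, by simpa using hp⟩
    · rcases s with _ | ⟨b, s⟩
      · exact Or.inr ⟨[], r, by simpa using h'.symm, by simpa using hp⟩
      · simp only [List.cons_append, List.cons.injEq] at h'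
        obtain ⟨rfl, rfl⟩ := h'
        exact Or.inl ⟨p, s, rfl, hp⟩
  · rintro (⟨p, r, rfl, hp⟩ | ⟨p, r, rfl, hp⟩)
    · exact ⟨p, r ++ y, by simp, hp⟩
    · exact ⟨x ++ p, r, by simp, by simpa using hp⟩

theorem edges_cons (w : V) (a : A) (y : List A) :
    edges δ w (a :: y) = {(w, a)} ∪ edges δ (δ w a) y := by
  have h : edges δ w [a] = {(w, a)} := by
    ext ⟨v, b⟩
    constructor
    · rintro ⟨p, r, h, hp⟩
      rcases p with _ | ⟨c, p⟩ <;> simp_all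
    · rintro ⟨⟩
      exact ⟨[], [], rfl, rfl⟩
  have := edges_append δ w [a] y
  rwa [h] at this

/-- A congruence on labelled paths for which the loops at each state form a semilattice. -/
structure IsLoopSemilattice (R : V → List A → List A → Prop) : Prop where
  refl : ∀ w x, R w x x
  symm : ∀ {w x y}, R w x y → R w y x
  trans : ∀ {w x y z}, R w x y → R w y z → R w x z
  append_right : ∀ {w x y} z, R w x y → R w (x ++ z) (y ++ z)
  append_left : ∀ {w x y} z, R (z.foldl δ w) x y → R w (z ++ x) (z ++ y)
  idem : ∀ {w x}, x.foldl δ w = w → R w (x ++ x) x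
  comm : ∀ {w x y}, x.foldl δ w = w → y.foldl δ w = w → R w (x ++ y) (y ++ x)

variable {δ} {R : V → List A → List A → Prop} (hR : IsLoopSemilattice δ R)

include hR

theorem exists_detour_right {w : V} {x : List A} (z : List A)
    (hz : edges δ (x.foldl δ w) z ⊆ edges δ w x) :
    ∃ y, (x ++ z ++ y).foldl δ w = x.foldl δ w ∧ R w x (x ++ z ++ y) := by
  induction z using List.reverseRecOn with
  | nil => exact ⟨[], by simp, by simpa using hR.refl w x⟩
  | append_singleton z a ih =>
    rw [edges_append, Set.union_subset_iff, edges_cons, Set.union_subset_iff] at hz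
    obtain ⟨y, hy, hxy⟩ := ih hz.1
    obtain ⟨x₁, x₂, hx, hr⟩ := hz.2.1 (Set.mem_singleton _)
    simp only at hx hr
    have hl : (a :: x₂ ++ z).foldl δ (x₁.foldl δ w) = x₁.foldl δ w := by
      rw [← List.foldl_append, ← List.append_assoc, ← hx, List.foldl_append, hr]
    have e1 : x ++ z ++ y = x₁ ++ ((a :: x₂ ++ z) ++ y) := by rw [hx]; simp
    have e2 : x ++ (z ++ [a]) ++ (x₂ ++ z ++ y)
        = x₁ ++ (((a :: x₂ ++ z) ++ (a :: x₂ ++ z)) ++ y) := by rw [hx]; simp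
    refine ⟨x₂ ++ z ++ y, ?_, hR.trans hxy ?_⟩
    · rw [← hy, e1, e2]
      simp only [List.foldl_append] at hl ⊢
      rw [hl, hl]
    · rw [e1, e2]
      exact hR.append_left _ (hR.append_right _ (hR.symm (hR.idem hl)))

theorem append_loop {w : V} {x z : List A} (hl : z.foldl δ (x.foldl δ w) = x.foldl δ w)
    (hz : edges δ (x.foldl δ w) z ⊆ edges δ w x) : R w (x ++ z) x := by
  obtain ⟨y, hy, hxy⟩ := exists_detour_right hR z hz
  have hy' : y.foldl δ (x.foldl δ w) = x.foldl δ w := by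
    simpa [List.foldl_append, hl] using hy
  have h1 := hR.append_right z hxy
  have h2 : R (x.foldl δ w) (z ++ y ++ z) (z ++ y) := by
    have h3 := hR.append_left z (w := x.foldl δ w) (x := y ++ z) (y := z ++ y)
      (by rw [hl]; exact hR.comm hy' hl)
    have h4 := hR.append_right y (hR.idem hl)
    simp only [List.append_assoc] at h3 h4 ⊢
    exact hR.trans h3 h4
  have h5 := hR.append_left x h2
  simp only [List.append_assoc] at h1 h5 hxy
  exact hR.trans h1 (hR.trans h5 (hR.symm hxy))

theorem exists_detour_left {w : V} {x : List A} (s : List A) (r : V) (hs : s.foldl δ r = w)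
    (hE : edges δ r s ⊆ edges δ w x) : ∃ y, y.foldl δ w = r ∧ R w x (y ++ s ++ x) := by
  induction s generalizing r with
  | nil => exact ⟨[], by simpa using hs.symm, by simpa using hR.refl w x⟩
  | cons a s ih =>
    rw [edges_cons, Set.union_subset_iff] at hE
    obtain ⟨y, hy, hxy⟩ := ih (δ r a) hs hE.2
    obtain ⟨x₁, x₂, hx, hr⟩ := hE.1 (Set.mem_singleton _)
    simp only at hx hr
    rw [List.foldl_cons] at hs
    have hl : (s ++ x₁ ++ [a]).foldl δ (y.foldl δ w) = y.foldl δ w := by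
      simp [List.foldl_append, hs, hr, hy]
    refine ⟨y ++ s ++ x₁, by simp [List.foldl_append, hy, hs, hr], hR.trans hxy ?_⟩
    have e1 : y ++ s ++ x = y ++ ((s ++ x₁ ++ [a]) ++ x₂) := by rw [hx]; simp
    have e2 : y ++ s ++ x₁ ++ (a :: s) ++ x
        = y ++ (((s ++ x₁ ++ [a]) ++ (s ++ x₁ ++ [a])) ++ x₂) := by rw [hx]; simp
    rw [e1, e2]
    exact hR.append_left _ (hR.append_right _ (hR.symm (hR.idem hl)))

theorem loop_append {w : V} {x z : List A} (hl : z.foldl δ w = w)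
    (hz : edges δ w z ⊆ edges δ w x) : R w (z ++ x) x := by
  obtain ⟨y, hy, hxy⟩ := exists_detour_left hR z w hl hz
  have h1 : R w (z ++ (y ++ z ++ x)) (y ++ z ++ x) := by
    have h3 := hR.append_right (z ++ x) (hR.comm hl hy)
    have h4 := hR.append_left y (w := w) (x := z ++ z ++ x) (y := z ++ x)
      (by rw [hy]; exact hR.append_right x (hR.idem hl))
    simp only [List.append_assoc] at h3 h4 ⊢
    exact hR.trans h3 h4
  have h2 := hR.append_left z (w := w) (x := x) (y := y ++ z ++ x) (by rw [hl]; exact hxy)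
  exact hR.trans h2 (hR.trans h1 (hR.symm hxy))

omit hR in
theorem edges_prefix_subset {w v : V} {a : A} {u s u' s' : List A} (hu : u.foldl δ w = v)
    (hE : edges δ w (u ++ a :: s) = edges δ w (u' ++ a :: s')) (hu' : u'.foldl δ w = v)
    (hno : ¬ ∃ z, z.foldl δ (δ v a) = v ∧ edges δ (δ v a) z ⊆ edges δ w (u ++ a :: s)) :
    edges δ w u ⊆ edges δ w u' := by
  rintro ⟨g, b⟩ hg
  have hg' : (g, b) ∈ edges δ w (u' ++ a :: s') := by
    rw [← hE, edges_append]; exact Or.inl hg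
  obtain ⟨p, r, hur, hp⟩ := hg
  simp only at hur hp
  have hrv : r.foldl δ (δ g b) = v := by rw [← hu, hur]; simp [hp]
  have hr : edges δ w (u ++ a :: s) = edges δ w p ∪ ({(g, b)} ∪ edges δ (δ g b) r)
      ∪ edges δ v (a :: s) := by
    rw [edges_append, hu, hur, edges_append, hp, edges_cons]
  rw [edges_append, hu', edges_cons] at hg'
  rcases hg' with hg' | hg' | ⟨p', r', hs', hp'⟩
  · exact hg'
  · obtain ⟨rfl, rfl⟩ := Prod.mk.inj hg'
    exact absurd ⟨r, hrv, by rw [hr]; grind⟩ hno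
  · simp only at hs' hp'
    refine absurd ⟨p' ++ b :: r, by simp [hp', hrv], ?_⟩ hno
    rw [edges_append, hp', edges_cons]
    have hE2 := hE
    rw [edges_append δ w u', hu', edges_cons, hs', edges_append δ (δ v a) p', hp', edges_cons] at hE2
    have : edges δ (δ v a) p' ⊆ edges δ w (u ++ a :: s) := by rw [hE2]; grind
    have h3 : {(g, b)} ∪ edges δ (δ g b) r ⊆ edges δ w (u ++ a :: s) := by rw [hr]; grind
    exact Set.union_subset this h3

omit hR in
theorem edges_suffix_subset {w v : V} {a : A} {u s u' s' : List A} (hu : u.foldl δ w = v)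
    (hE : edges δ w (u ++ a :: s) = edges δ w (u' ++ a :: s')) (hu' : u'.foldl δ w = v)
    (hno : ¬ ∃ z, z.foldl δ (δ v a) = v ∧ edges δ (δ v a) z ⊆ edges δ w (u ++ a :: s)) :
    edges δ (δ v a) s ⊆ edges δ (δ v a) s' := by
  rintro ⟨g, b⟩ hg
  have hg' : (g, b) ∈ edges δ w (u' ++ a :: s') := by
    rw [← hE, edges_append, hu, edges_cons]; exact Or.inr (Or.inr hg)
  obtain ⟨p, r, hsr, hp⟩ := hg
  simp only at hsr hp
  have hr : edges δ w (u ++ a :: s) = edges δ w u ∪ ({(v, a)} ∪ (edges δ (δ v a) p ∪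
      ({(g, b)} ∪ edges δ (δ g b) r))) := by
    rw [edges_append, hu, hsr, edges_cons, edges_append, hp, edges_cons]
  rw [edges_append, hu', edges_cons] at hg'
  rcases hg' with ⟨p', r', hs', hp'⟩ | hg' | hg'
  · simp only at hs' hp'
    have hrv : r'.foldl δ (δ g b) = v := by rw [← hu', hs']; simp [hp']
    refine absurd ⟨p ++ b :: r', by simp [hp, hrv], ?_⟩ hno
    rw [edges_append, hp, edges_cons]
    have hE2 := hE
    rw [edges_append δ w u', hs', edges_append δ w p', hp', edges_cons] at hE2
    have : {(g, b)} ∪ edges δ (δ g b) r' ⊆ edges δ w (u ++ a :: s) := by rw [hE2]; grind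
    have h3 : edges δ (δ v a) p ⊆ edges δ w (u ++ a :: s) := by rw [hr]; grind
    exact Set.union_subset h3 this
  · obtain ⟨rfl, rfl⟩ := Prod.mk.inj hg'
    exact absurd ⟨p, hp, by rw [hr]; grind⟩ hno
  · exact hg'

/-- Simon's theorem: coterminal paths traversing the same edges are congruent. -/
theorem rel_of_edges_eq {w : V} {x y : List A} (hxy : x.foldl δ w = y.foldl δ w)
    (hE : edges δ w x = edges δ w y) : R w x y := by
  by_cases hret : ∀ v a, (v, a) ∈ edges δ w x →
      ∃ z, z.foldl δ (δ v a) = v ∧ edges δ (δ v a) z ⊆ edges δ w x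
  · have hback : ∀ p r, x = p ++ r → ∃ t, t.foldl δ (p.foldl δ w) = w ∧
        edges δ (p.foldl δ w) t ⊆ edges δ w x := by
      intro p
      induction p using List.reverseRecOn with
      | nil => exact fun r _ => ⟨[], rfl, by rintro _ ⟨p, r, h, _⟩; simp at h⟩
      | append_singleton p a ih =>
        intro r hr
        obtain ⟨t, ht, hEt⟩ := ih (a :: r) (by simpa using hr)
        obtain ⟨z, hz, hEz⟩ := hret (p.foldl δ w) a ⟨p, r, by simpa using hr, rfl⟩
        refine ⟨z ++ t, by simp [hz, ht], ?_⟩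
        rw [edges_append]
        simp only [List.foldl_append, List.foldl_cons, List.foldl_nil, hz]
        exact Set.union_subset hEz hEt
    obtain ⟨t, ht, hEt⟩ := hback x [] (by simp)
    have h1 : R w (x ++ (t ++ y)) x :=
      append_loop hR (by rw [List.foldl_append, ht, hxy]) (by
        rw [edges_append, ht]; exact Set.union_subset hEt hE.ge)
    have h2 : R w ((x ++ t) ++ y) y :=
      loop_append hR (by simp [ht]) (by
        rw [edges_append]; exact Set.union_subset hE.le (hEt.trans hE.le))
    rw [List.append_assoc] at h2
    exact hR.trans (hR.symm h1) h2
  · push Not at hret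
    obtain ⟨v, a, hva, hno⟩ := hret
    have hno' : ¬ ∃ z, z.foldl δ (δ v a) = v ∧ edges δ (δ v a) z ⊆ edges δ w x := by
      rintro ⟨z, h1, h2⟩; exact hno z h1 h2
    have hva' := hE ▸ hva
    obtain ⟨u, s, hx, hu⟩ := hva
    obtain ⟨u', s', hy, hu'⟩ := hva'
    simp only at hx hu hy hu'
    have hno2 := hE ▸ hno'
    have h1 : R w u u' := rel_of_edges_eq (hu.trans hu'.symm) <| by
      subst hx hy
      exact (edges_prefix_subset hu hE hu' hno').antisymm
        (edges_prefix_subset hu' hE.symm hu hno2)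
    have h2 : R (δ v a) s s' := rel_of_edges_eq
      (by simpa [hx, hy, hu, hu'] using hxy) <| by
      subst hx hy
      exact (edges_suffix_subset hu hE hu' hno').antisymm
        (edges_suffix_subset hu' hE.symm hu hno2)
    have h3 : R w ((u' ++ [a]) ++ s) ((u' ++ [a]) ++ s') :=
      hR.append_left _ (by simpa [hu'] using h2)
    have h4 := hR.append_right (a :: s) h1
    simp only [List.append_assoc, List.singleton_append] at h3
    rw [hx, hy]
    exact hR.trans h4 h3
termination_by x.length
decreasing_by all_goals (simp [hx]; try omega)

end Paths

section Window

variable {A : Type}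

/-- Reading a letter in a sliding window of fixed length. -/
def slide (w : List A) (a : A) : List A := (w ++ [a]).drop 1

theorem foldl_slide (w x : List A) : x.foldl slide w = (w ++ x).drop x.length := by
  induction x generalizing w with
  | nil => simp
  | cons a x ih =>
    rw [List.foldl_cons, ih, slide]
    rcases w with _ | ⟨b, w⟩ <;> simp

theorem length_foldl_slide (w x : List A) : (x.foldl slide w).length = w.length := by
  simp [foldl_slide]

theorem take_append_foldl_slide (w x : List A) :
    (w ++ x).take x.length ++ x.foldl slide w = w ++ x := by
  rw [foldl_slide, List.take_append_drop]

theorem mem_edges_slide {w x v : List A} {a : A} :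
    (v, a) ∈ edges slide w x ↔ v.length = w.length ∧ v ++ [a] <:+: w ++ x := by
  constructor
  · rintro ⟨p, r, rfl, rfl⟩
    refine ⟨length_foldl_slide _ _, (w ++ p).take p.length, r, ?_⟩
    dsimp only
    rw [← List.append_assoc, take_append_foldl_slide]
    simp
  · rintro ⟨hv, s, t, h⟩
    have hl : s.length + (v.length + 1) + t.length = w.length + x.length := by
      have := congrArg List.length h
      simp at this; omega
    have h1 : w <+: s ++ v := List.prefix_of_prefix_length_le (List.prefix_append w x)
      ⟨a :: t, by rw [← h]; simp⟩ (by simp; omega)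
    obtain ⟨p, hp⟩ := h1
    have hx : x = p ++ a :: t := by
      have : w ++ x = w ++ (p ++ a :: t) := by
        rw [← h, ← List.append_assoc w, hp]; simp
      exact List.append_cancel_left this
    refine ⟨p, t, hx, ?_⟩
    have hpl : p.length = s.length := by
      have := congrArg List.length hp
      simp at this; omega
    rw [foldl_slide, hp, hpl]; simp

end Window

section Monoid

variable {A Q : Type}

theorem exists_lt_map_eq [Finite Q] (g : ℕ → Q) : ∃ i j, i < j ∧ j ≤ Nat.card Q ∧ g i = g j := by
  have := Fintype.ofFinite Q
  obtain ⟨i, j, hij, h⟩ := Fintype.exists_ne_map_eq_of_card_lt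
    (fun i : Fin (Nat.card Q + 1) => g i) (by simp [Nat.card_eq_fintype_card])
  rcases lt_or_gt_of_ne hij with h' | h'
  · exact ⟨i, j, h', by omega, h⟩
  · exact ⟨j, i, h', by omega, h.symm⟩

variable [Monoid Q]

theorem pow_add_mul_eq {q : Q} {i p : ℕ} (h : q ^ i = q ^ (i + p)) (b : ℕ) :
    q ^ i = q ^ (i + b * p) := by
  induction b with
  | zero => simp
  | succ b ih => rw [Nat.succ_mul, ← add_assoc, add_right_comm, pow_add, ← h, ← pow_add, ← ih]

variable [Finite Q]

theorem exists_pow_idempotent (q : Q) : ∃ m, 1 ≤ m ∧ q ^ m * q ^ m = q ^ m := by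
  obtain ⟨i, j, hij, -, h⟩ := exists_lt_map_eq fun i => q ^ i
  obtain ⟨p, rfl⟩ := Nat.exists_eq_add_of_lt hij
  rw [add_assoc] at h
  have h1 := pow_add_mul_eq h (i + 1)
  obtain ⟨c, hc⟩ : ∃ c, (i + 1) * (p + 1) = i + c := ⟨(i + 1) * (p + 1) - i, by
    have : i + 1 ≤ (i + 1) * (p + 1) := Nat.le_mul_of_pos_right _ (by omega)
    omega⟩
  refine ⟨(i + 1) * (p + 1), Nat.mul_pos (by omega) (by omega), ?_⟩
  rw [← pow_add]
  calc q ^ ((i + 1) * (p + 1) + (i + 1) * (p + 1))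
      = q ^ (i + (i + 1) * (p + 1)) * q ^ c := by rw [← pow_add]; congr 1; omega
    _ = q ^ ((i + 1) * (p + 1)) := by rw [← h1, ← pow_add, ← hc]

/-- The images of nonempty words form a local semilattice. -/
def IsLocalSemilattice (φ : FreeMonoid A →* Q) : Prop :=
  ∀ e x y : FreeMonoid A, e ≠ 1 → x ≠ 1 → y ≠ 1 → φ e * φ e = φ e →
    (φ e * φ x * φ e) * (φ e * φ x * φ e) = φ e * φ x * φ e ∧
    (φ e * φ x * φ e) * (φ e * φ y * φ e) = (φ e * φ y * φ e) * (φ e * φ x * φ e)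

variable {φ : FreeMonoid A →* Q}

theorem pow_ne_one_of_ne_one {x : FreeMonoid A} (hx : x ≠ 1) {m : ℕ} (hm : 1 ≤ m) :
    x ^ m ≠ 1 := by
  intro h
  have h1 := congrArg FreeMonoid.length h
  have h2 : FreeMonoid.length x ≠ 0 := by simpa using hx
  have h3 : ∀ m, FreeMonoid.length (x ^ m) = m * FreeMonoid.length x := by
    intro m
    induction m with
    | zero => simp
    | succ m ih => rw [pow_succ, FreeMonoid.length_mul, ih]; ring
  rw [h3, FreeMonoid.length_one] at h1
  rcases Nat.mul_eq_zero.1 h1 with h | h <;> omega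

theorem IsLocalSemilattice.pow_card (h : IsLocalSemilattice φ) {x : FreeMonoid A}
    (hx : x ≠ 1) : φ x ^ (Nat.card Q + 1) = φ x ^ Nat.card Q := by
  obtain ⟨m, hm, he⟩ := exists_pow_idempotent (φ x)
  obtain ⟨i, j, hij, hj, hp⟩ := exists_lt_map_eq fun i => φ x ^ i
  obtain ⟨p, rfl⟩ := Nat.exists_eq_add_of_lt hij
  rw [add_assoc] at hp
  have h1 := (h (x ^ m) x x (pow_ne_one_of_ne_one hx hm) hx hx (by simpa using he)).1
  simp only [map_pow] at h1
  have hap : φ x ^ (m + 2) = φ x ^ (m + 1) := by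
    have e1 : φ x ^ m * φ x * φ x ^ m = φ x ^ (m + 1) := by
      rw [mul_assoc, ← pow_succ', pow_succ, ← mul_assoc, he]
    rw [e1, ← pow_add] at h1
    rw [← h1, show m + 1 + (m + 1) = m + m + 2 by omega, pow_add _ (m + m), pow_add _ m m, he,
      ← pow_add]
  have hb := pow_add_mul_eq hp (m + 1)
  have hi : φ x ^ (i + 1) = φ x ^ i := by
    have hle : m + 1 ≤ i + (m + 1) * (p + 1) := by nlinarith [Nat.zero_le (m * p)]
    obtain ⟨c, hc⟩ := Nat.exists_eq_add_of_le hle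
    rw [pow_succ, hb, hc, ← pow_succ, show m + 1 + c + 1 = m + 2 + c by omega, pow_add, hap,
      ← pow_add]
  obtain ⟨d, hd⟩ := Nat.exists_eq_add_of_le (show i ≤ Nat.card Q by omega)
  rw [hd, show i + d + 1 = i + 1 + d by omega, pow_add, hi, ← pow_add]

theorem exists_prefix_absorbing (φ : FreeMonoid A →* Q) {w : FreeMonoid A}
    (hw : Nat.card Q ≤ w.length) :
    ∃ w₁ w₂ e : FreeMonoid A, w = w₁ * w₂ ∧ w₁.length ≤ Nat.card Q ∧ e ≠ 1 ∧
      φ e * φ e = φ e ∧ φ w₁ * φ e = φ w₁ := by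
  obtain ⟨i, j, hij, hj, h⟩ := exists_lt_map_eq fun i =>
    φ (FreeMonoid.ofList (w.toList.take i))
  set f : FreeMonoid A := FreeMonoid.ofList ((w.toList.take j).drop i) with hf
  have hwj : FreeMonoid.ofList (w.toList.take j) = FreeMonoid.ofList (w.toList.take i) * f := by
    rw [hf, ← FreeMonoid.ofList_append]
    conv_lhs => rw [← List.take_append_drop i (w.toList.take j)]
    rw [List.take_take, min_eq_left hij.le]
  have hf1 : f ≠ 1 := by
    intro h1
    have h2 := congrArg FreeMonoid.length h1
    have hwl : w.toList.length = w.length := rfl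
    have h3 : f.length = ((w.toList.take j).drop i).length := rfl
    rw [FreeMonoid.length_one, h3, List.length_drop, List.length_take] at h2
    omega
  obtain ⟨m, hm, he⟩ := exists_pow_idempotent (φ f)
  rw [hwj, map_mul] at h
  refine ⟨FreeMonoid.ofList (w.toList.take i), FreeMonoid.ofList (w.toList.drop i), f ^ m, ?_, ?_,
    pow_ne_one_of_ne_one hf1 hm, by simpa using he, ?_⟩
  · rw [← FreeMonoid.ofList_append, List.take_append_drop, FreeMonoid.ofList_toList]
  · have : (FreeMonoid.ofList (w.toList.take i)).length = (w.toList.take i).length := rfl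
    rw [this, List.length_take]; omega
  · rw [map_pow]
    clear hm he
    induction m with
    | zero => simp
    | succ m ih => rw [pow_succ', ← mul_assoc, ← h, ih]

theorem exists_eq_pow_mul {w x x' : FreeMonoid A} (hx : w * x = x' * w) (m : ℕ)
    (hm : m * x'.length ≤ w.length) : ∃ r, w = x' ^ m * r := by
  induction m with
  | zero => exact ⟨w, by simp⟩
  | succ m ih =>
    obtain ⟨r, hr⟩ := ih (by rw [Nat.succ_mul] at hm; omega)
    have h1 : x' ^ m * (r * x) = x' ^ m * (x' * r) := by
      rw [← mul_assoc, ← hr, hx, ← mul_assoc, ← pow_succ, pow_succ', mul_assoc, ← hr]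
    have h2 : r * x = x' * r := List.append_cancel_left h1
    have hlen : ∀ m, FreeMonoid.length (x' ^ m) = m * x'.length := by
      intro m
      induction m with
      | zero => simp
      | succ m ih => rw [pow_succ, FreeMonoid.length_mul, ih]; ring
    have h3 : x'.length ≤ r.length := by
      rw [hr, FreeMonoid.length_mul, hlen, Nat.succ_mul] at hm; omega
    obtain ⟨r', hr'⟩ : x'.toList <+: r.toList :=
      List.prefix_of_prefix_length_le (l₃ := (r * x).toList) ⟨r.toList, by rw [h2]; rfl⟩
        ⟨x.toList, rfl⟩ h3
    exact ⟨FreeMonoid.ofList r', by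
      rw [hr, pow_succ, mul_assoc]; congr 1; exact hr'.symm⟩

/-- A loop at a long enough window either is absorbed, or its image is an element of the
semilattice of a common idempotent, conjugated. -/
theorem IsLocalSemilattice.loops (h : IsLocalSemilattice φ) {w x y : FreeMonoid A}
    {x' y' : FreeMonoid A} (hw : Nat.card Q * (Nat.card Q + 1) ≤ w.length)
    (hx : w * x = x' * w) (hy : w * y = y' * w) :
    φ (w * x * x) = φ (w * x) ∧ φ (w * x * y) = φ (w * y * x) := by
  obtain ⟨w₁, w₂, e, hw12, hw1, he1, hee, hwe⟩ := exists_prefix_absorbing φ (w := w) (by nlinarith)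
  have hshort : ∀ z z' : FreeMonoid A, w * z = z' * w → z' ≠ 1 → z'.length < w₁.length →
      φ (w * z) = φ w := by
    intro z z' hz hz1 hl
    obtain ⟨r, hr⟩ := exists_eq_pow_mul hz (Nat.card Q) (by nlinarith)
    rw [hz, hr, ← mul_assoc, ← pow_succ', map_mul, map_mul, map_pow, map_pow, h.pow_card hz1]
  have hlong : ∀ z z' : FreeMonoid A, w * z = z' * w → w₁.length ≤ z'.length →
      ∃ t, z' = w₁ * t := by
    intro z z' hz hl
    obtain ⟨t, ht⟩ : w₁.toList <+: z'.toList :=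
      List.prefix_of_prefix_length_le (l₃ := (z' * w).toList)
        ⟨(w₂ * z).toList, by
          rw [← hz, hw12, mul_assoc]; rfl⟩ ⟨w.toList, rfl⟩ hl
    exact ⟨FreeMonoid.ofList t, ht.symm⟩
  have hone : ∀ z z' : FreeMonoid A, w * z = z' * w → z' = 1 → φ (w * z) = φ w := by
    rintro z z' hz rfl
    rw [hz, one_mul]
  have key : ∀ z z' : FreeMonoid A, w * z = z' * w →
      φ (w * z) = φ w ∨ (z' ≠ 1 ∧ ∃ t, z' = w₁ * t) := by
    intro z z' hz
    by_cases h1 : z' = 1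
    · exact Or.inl (hone z z' hz h1)
    · rcases lt_or_ge z'.length w₁.length with hl | hl
      · exact Or.inl (hshort z z' hz h1 hl)
      · exact Or.inr ⟨h1, hlong z z' hz hl⟩
  have hxx : w * x * x = x' * (w * x) := by rw [hx, mul_assoc, hx]
  have hxy : w * x * y = x' * (w * y) := by rw [hx, mul_assoc]
  have hyx : w * y * x = y' * (w * x) := by rw [hy, mul_assoc]
  rcases key x x' hx with hxs | ⟨hx1, t, rfl⟩
  · refine ⟨by rw [map_mul _ (w * x), hxs, ← map_mul, hxs], ?_⟩
    rw [map_mul _ (w * x), hxs, ← map_mul, hyx, map_mul _ y', hxs, ← map_mul, hy]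
  · have conj : ∀ s : FreeMonoid A, φ (w₁ * s * w₁) = φ w₁ * (φ e * φ (s * w₁) * φ e) := by
      intro s
      calc φ (w₁ * s * w₁) = φ w₁ * φ s * φ w₁ := by simp
        _ = (φ w₁ * φ e) * φ s * (φ w₁ * φ e) := by rw [hwe]
        _ = _ := by simp [mul_assoc]
    have conj2 : ∀ s t : FreeMonoid A, φ (w₁ * s * (w₁ * t * w₁)) =
        φ w₁ * ((φ e * φ (s * w₁) * φ e) * (φ e * φ (t * w₁) * φ e)) := by
      intro s t
      calc φ (w₁ * s * (w₁ * t * w₁)) = φ w₁ * φ s * φ w₁ * φ t * φ w₁ := by simp [mul_assoc]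
        _ = (φ w₁ * φ e) * φ s * (φ w₁ * (φ e * φ e)) * φ t * (φ w₁ * φ e) := by
          rw [hee, hwe]
        _ = _ := by simp [mul_assoc]
    have hne : ∀ s : FreeMonoid A, w₁ * s ≠ 1 → s * w₁ ≠ 1 := by
      intro s hs h0
      apply hs
      rw [← FreeMonoid.length_eq_zero, FreeMonoid.length_mul] at h0 ⊢
      omega
    constructor
    · rw [hxx, hx, hw12]
      have h1 := (h e (t * w₁) (t * w₁) he1 (hne t hx1) (hne t hx1) hee).1
      have e1 : w₁ * t * (w₁ * t * (w₁ * w₂)) = w₁ * t * (w₁ * t * w₁) * w₂ := by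
        simp [mul_assoc]
      have e2 : w₁ * t * (w₁ * w₂) = w₁ * t * w₁ * w₂ := by simp [mul_assoc]
      rw [e1, e2, map_mul, map_mul _ (w₁ * t * w₁), conj2, conj, h1]
    · rcases key y y' hy with hys | ⟨hy1, s, rfl⟩
      · rw [hxy, map_mul, hys, ← map_mul, ← hx, map_mul _ (w * y), hys, ← map_mul]
      · rw [hxy, hyx, hx, hy, hw12]
        have h1 := (h e (t * w₁) (s * w₁) he1 (hne t hx1) (hne s hy1) hee).2
        have e1 : ∀ t s, w₁ * t * (w₁ * s * (w₁ * w₂)) = w₁ * t * (w₁ * s * w₁) * w₂ := by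
          simp [mul_assoc]
        rw [e1, e1, map_mul, map_mul _ (w₁ * s * (w₁ * t * w₁)), conj2, conj2, h1]

/-- Reading words in a sufficiently long sliding window satisfies the hypotheses of Simon's
theorem. -/
theorem IsLocalSemilattice.isLoopSemilattice (h : IsLocalSemilattice φ) {n : ℕ}
    (hn : Nat.card Q * (Nat.card Q + 1) ≤ n) :
    IsLoopSemilattice (slide (A := A)) fun w x y => w.length = n →
      φ (FreeMonoid.ofList (w ++ x)) = φ (FreeMonoid.ofList (w ++ y)) where
  refl _ _ _ := rfl
  symm h hw := (h hw).symm
  trans h h' hw := (h hw).trans (h' hw)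
  append_right z h hw := by
    rw [← List.append_assoc, ← List.append_assoc, FreeMonoid.ofList_append, map_mul, h hw,
      ← map_mul, ← FreeMonoid.ofList_append]
  append_left {w x y} z h hw := by
    have h1 := h ((length_foldl_slide w z).trans hw)
    rw [← List.append_assoc, ← List.append_assoc, ← take_append_foldl_slide w z,
      List.append_assoc, List.append_assoc, FreeMonoid.ofList_append, map_mul, h1,
      ← map_mul, ← FreeMonoid.ofList_append]
  idem {w x} hx hw := by
    have h1 := take_append_foldl_slide w x
    rw [hx] at h1
    rw [← List.append_assoc]
    exact (h.loops (w := FreeMonoid.ofList w) (x := FreeMonoid.ofList x)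
      (hn.trans hw.ge) (congrArg FreeMonoid.ofList h1).symm
      (congrArg FreeMonoid.ofList h1).symm).1
  comm {w x y} hx hy hw := by
    have h1 := take_append_foldl_slide w x
    have h2 := take_append_foldl_slide w y
    rw [hx] at h1
    rw [hy] at h2
    rw [← List.append_assoc, ← List.append_assoc]
    exact (h.loops (w := FreeMonoid.ofList w) (x := FreeMonoid.ofList x)
      (y := FreeMonoid.ofList y) (hn.trans hw.ge) (congrArg FreeMonoid.ofList h1).symm
      (congrArg FreeMonoid.ofList h2).symm).2

theorem IsLocalSemilattice.map_eq (h : IsLocalSemilattice φ) {n : ℕ}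
    (hn : Nat.card Q * (Nat.card Q + 1) ≤ n) {u v : List A} (hu : n + 1 ≤ u.length)
    (hv : n + 1 ≤ v.length) (hpre : u.take (n + 1) = v.take (n + 1))
    (hsuf : u.drop (u.length - (n + 1)) = v.drop (v.length - (n + 1)))
    (hfac : {w : List A | w.length = n + 1 ∧ w.IsInfix u} =
      {w : List A | w.length = n + 1 ∧ w.IsInfix v}) :
    φ (FreeMonoid.ofList u) = φ (FreeMonoid.ofList v) := by
  have hp : u.take n = v.take n := by
    simpa [List.take_take] using congrArg (List.take n) hpre
  have hs : u.drop (u.length - n) = v.drop (v.length - n) := by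
    have h1 := congrArg (List.drop 1) hsuf
    rw [List.drop_drop, List.drop_drop] at h1
    rwa [show u.length - (n + 1) + 1 = u.length - n by omega,
      show v.length - (n + 1) + 1 = v.length - n by omega] at h1
  have hlen : (u.take n).length = n := by rw [List.length_take]; omega
  have hv' : u.take n ++ v.drop n = v := by rw [hp, List.take_append_drop]
  have key := rel_of_edges_eq (h.isLoopSemilattice hn) (w := u.take n) (x := u.drop n)
    (y := v.drop n) ?_ ?_ hlen
  · rwa [List.take_append_drop, hv'] at key
  · rw [foldl_slide, foldl_slide, List.take_append_drop, hv', List.length_drop, List.length_drop,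
      hs]
  · ext ⟨g, a⟩
    rw [mem_edges_slide, mem_edges_slide, List.take_append_drop, hv', hlen]
    have h1 := Set.ext_iff.1 hfac (g ++ [a])
    simp only [Set.mem_ofPred_eq, List.length_append, List.length_singleton,
      Nat.add_right_cancel_iff] at h1
    exact h1

end Monoid

section Syntactic

variable {A : Type} {L : Set (List A)}

theorem synRel_append {x x' y y' : List A} (hx : SynRel L x x') (hy : SynRel L y y') :
    SynRel L (x ++ y) (x' ++ y') := by
  intro u v
  have h1 := hx u (y ++ v)
  have h2 := hy (u ++ x') v
  simp only [List.append_assoc] at h1 h2 ⊢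
  exact h1.trans h2

/-- The syntactic congruence as a monoid congruence. -/
def synCon (L : Set (List A)) : Con (FreeMonoid A) where
  r := SynRel L
  iseqv := (synSetoid L).iseqv
  mul' := synRel_append

theorem mk'_eq_iff {x y : List A} :
    (synCon L).mk' (FreeMonoid.ofList x) = (synCon L).mk' (FreeMonoid.ofList y) ↔
      SynRel L x y :=
  (synCon L).eq

theorem mem_iff_of_synRel {x y : List A} (h : SynRel L x y) : x ∈ L ↔ y ∈ L := by
  simpa using h [] []

theorem locallyTestable_of_localSemilattice (hfin : Finite (Quotient (synSetoid L)))
    (h : ∀ e x y : List A, e ≠ [] → x ≠ [] → y ≠ [] → SynRel L (e ++ e) e →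
        SynRel L ((e ++ x ++ e) ++ (e ++ x ++ e)) (e ++ x ++ e) ∧
        SynRel L ((e ++ x ++ e) ++ (e ++ y ++ e)) ((e ++ y ++ e) ++ (e ++ x ++ e))) :
    LocallyTestable L := by
  have : Finite (synCon L).Quotient := hfin
  have hloc : IsLocalSemilattice (synCon L).mk' := by
    intro e x y he hx hy hee
    have h1 := h e.toList x.toList y.toList he hx hy (mk'_eq_iff.1 (by simpa using hee))
    rw [← mk'_eq_iff, ← mk'_eq_iff] at h1
    simpa [mul_assoc] using h1
  refine ⟨_, Nat.le_add_left 1 _, fun u v hu hv hpre hsuf hfac =>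
    mem_iff_of_synRel
    (mk'_eq_iff.1 (hloc.map_eq le_rfl hu hv hpre hsuf hfac))⟩

/-- The factors of length `k` of a word. -/
def factors (k : ℕ) (u : List A) : Set (List A) := {w | w.length = k ∧ w <:+: u}

theorem factors_append_append {k : ℕ} {E : List A} (hE : k ≤ E.length) (P Q : List A) :
    factors k (P ++ E ++ Q) = factors k (P ++ E) ∪ factors k (E ++ Q) := by
  ext w
  constructor
  · rintro ⟨hw, s, t, h⟩
    rcases le_total P.length s.length with hl | hl
    · right
      obtain ⟨s', rfl⟩ : P <+: s := List.prefix_of_prefix_length_le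
        (l₃ := P ++ E ++ Q) ⟨E ++ Q, by simp⟩ ⟨w ++ t, by rw [← h]; simp⟩ hl
      refine ⟨hw, s', t, ?_⟩
      simpa using h
    · left
      have h1 : s ++ w <+: P ++ E := List.prefix_of_prefix_length_le
        (l₃ := P ++ E ++ Q) ⟨t, h⟩ ⟨Q, rfl⟩ (by simp; omega)
      exact ⟨hw, (List.infix_append' s w []).trans (by simpa using h1.isInfix)⟩
  · rintro (⟨hw, h⟩ | ⟨hw, h⟩)
    · exact ⟨hw, h.trans (List.infix_append' [] _ Q)⟩
    · exact ⟨hw, h.trans ⟨P, [], by simp⟩⟩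

theorem take_append_append {k : ℕ} {E : List A} (hE : k ≤ E.length) (P Q : List A) :
    (P ++ E ++ Q).take k = (P ++ E).take k :=
  List.take_append_of_le_length (by simp; omega)

theorem drop_append_append {k : ℕ} {E : List A} (hE : k ≤ E.length) (P Q : List A) :
    (P ++ (E ++ Q)).drop ((P ++ (E ++ Q)).length - k) =
      (E ++ Q).drop ((E ++ Q).length - k) := by
  rw [List.drop_append, List.drop_eq_nil_of_le (by simp; omega), List.nil_append]
  congr 1
  simp; omega

theorem synRel_of_factors {k : ℕ}
    (h : ∀ u v : List A, k ≤ u.length → k ≤ v.length → u.take k = v.take k →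
      u.drop (u.length - k) = v.drop (v.length - k) → factors k u = factors k v →
      (u ∈ L ↔ v ∈ L)) {E : List A} (hE : k ≤ E.length) {x y : List A}
    (hxy : factors k (E ++ x ++ E) = factors k (E ++ y ++ E)) :
    SynRel L (E ++ x ++ E) (E ++ y ++ E) := by
  intro u v
  have hf : ∀ x, factors k (u ++ (E ++ x ++ E) ++ v) =
      factors k (u ++ E) ∪ (factors k (E ++ x ++ E) ∪ factors k (E ++ v)) := by
    intro x
    have e1 : u ++ (E ++ x ++ E) ++ v = u ++ E ++ (x ++ E ++ v) := by simp
    have e2 : E ++ (x ++ E ++ v) = E ++ x ++ E ++ v := by simp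
    rw [e1, factors_append_append hE, e2, factors_append_append hE]
  have ht : ∀ x, (u ++ (E ++ x ++ E) ++ v).take k = (u ++ E).take k := by
    intro x
    rw [← take_append_append hE u (x ++ E ++ v)]
    simp
  have hd : ∀ x, (u ++ (E ++ x ++ E) ++ v).drop ((u ++ (E ++ x ++ E) ++ v).length - k) =
      (E ++ v).drop ((E ++ v).length - k) := by
    intro x
    rw [← drop_append_append hE (u ++ E ++ x) v]
    simp
  refine h _ _ (by simp; omega) (by simp; omega) ?_ ?_ ?_
  · rw [ht, ht]
  · rw [hd, hd]
  · rw [hf, hf, hxy]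

theorem exists_synRel_le_length {e : List A} (he : e ≠ []) (hee : SynRel L (e ++ e) e) (k : ℕ) :
    ∃ E, k ≤ E.length ∧ SynRel L e E := by
  induction k with
  | zero => exact ⟨e, by simp, (synSetoid L).refl e⟩
  | succ k ih =>
    obtain ⟨E, hE, h⟩ := ih
    refine ⟨e ++ E, ?_, (synSetoid L).trans ((synSetoid L).symm hee)
      (synRel_append ((synSetoid L).refl e) h)⟩
    have := List.length_pos_of_ne_nil he
    simp; omega

theorem localSemilattice_of_locallyTestable (h : LocallyTestable L) {e : List A} (x y : List A)
    (he : e ≠ []) (hee : SynRel L (e ++ e) e) :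
    SynRel L ((e ++ x ++ e) ++ (e ++ x ++ e)) (e ++ x ++ e) ∧
      SynRel L ((e ++ x ++ e) ++ (e ++ y ++ e)) ((e ++ y ++ e) ++ (e ++ x ++ e)) := by
  obtain ⟨k, -, hk⟩ := h
  obtain ⟨E, hE, heE⟩ := exists_synRel_le_length he hee k
  have hf : ∀ x y, factors k (E ++ (x ++ E ++ y) ++ E) =
      factors k (E ++ x ++ E) ∪ factors k (E ++ y ++ E) := by
    intro x y
    have := factors_append_append hE (E ++ x) (y ++ E)
    simpa using this
  have h1 := synRel_of_factors hk hE (x := x ++ E ++ x) (y := x) (by rw [hf, Set.union_self])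
  have h2 := synRel_of_factors hk hE (x := x ++ E ++ y) (y := y ++ E ++ x)
    (by rw [hf, hf, Set.union_comm])
  rw [← mk'_eq_iff] at h1 h2 heE hee
  simp only [FreeMonoid.ofList_append, map_mul, ← heE] at h1 h2 hee
  rw [← mk'_eq_iff, ← mk'_eq_iff]
  simp only [FreeMonoid.ofList_append, map_mul]
  generalize (synCon L).mk' (FreeMonoid.ofList e) = e at *
  have hee' : ∀ q, e * (e * q) = e * q := fun q => by rw [← mul_assoc, hee]
  simp only [mul_assoc, hee'] at h1 h2 ⊢
  exact ⟨h1, h2⟩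

theorem finite_quotient_of_locallyTestable [Finite A] (h : LocallyTestable L) :
    Finite (Quotient (synSetoid L)) := by
  obtain ⟨k, -, hk⟩ := h
  let τ : List A → List A × List A × Set (List A) := fun x =>
    (x.take k, x.drop (x.length - k), factors k x)
  have hτ : ∀ x y, τ x = τ y → SynRel L x y := by
    intro x y hxy u v
    simp only [τ, Prod.mk.injEq] at hxy
    obtain ⟨h1, h2, h3⟩ := hxy
    have hl := congrArg List.length h1
    rw [List.length_take, List.length_take] at hl
    rcases lt_or_ge x.length k with hx | hx
    · rw [List.take_of_length_le hx.le, List.take_of_length_le (by omega)] at h1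
      rw [h1]
    · have hy : k ≤ y.length := by omega
      have hs : ∀ z : List A, k ≤ z.length → ∃ z', z = z' ++ z.drop (z.length - k) ∧
          (z.drop (z.length - k)).length = k := fun z hz =>
        ⟨z.take (z.length - k), (List.take_append_drop _ _).symm, by simp; omega⟩
      have ht : ∀ z : List A, k ≤ z.length → ∃ z', z = z.take k ++ z' ∧ (z.take k).length = k :=
        fun z hz => ⟨z.drop k, (List.take_append_drop _ _).symm, by simp; omega⟩
      have hf : ∀ z : List A, k ≤ z.length → factors k (u ++ z ++ v) =
          factors k (u ++ z.take k) ∪ factors k z ∪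
            factors k (z.drop (z.length - k) ++ v) := by
        intro z hz
        obtain ⟨p, hp, hpl⟩ := hs z hz
        obtain ⟨q, hq, hql⟩ := ht z hz
        have e1 : u ++ z ++ v = u ++ p ++ z.drop (z.length - k) ++ v := by
          conv_lhs => rw [hp]
          simp
        have e2 : u ++ p ++ z.drop (z.length - k) = u ++ z.take k ++ q := by
          rw [List.append_assoc, ← hp, List.append_assoc, ← hq]
        rw [e1, factors_append_append hpl.ge, e2, factors_append_append hql.ge, ← hq]
      refine hk _ _ (by simp; omega) (by simp; omega) ?_ ?_ ?_
      · obtain ⟨p, hp, hpl⟩ := ht x hx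
        obtain ⟨q, hq, hql⟩ := ht y hy
        have e := take_append_append hpl.ge u (p ++ v)
        have e' := take_append_append hql.ge u (q ++ v)
        rw [List.append_assoc, ← List.append_assoc _ p, ← hp, ← List.append_assoc] at e
        rw [List.append_assoc, ← List.append_assoc _ q, ← hq, ← List.append_assoc] at e'
        rw [e, e', h1]
      · obtain ⟨p, hp, hpl⟩ := hs x hx
        obtain ⟨q, hq, hql⟩ := hs y hy
        have e := drop_append_append hpl.ge (u ++ p) v
        have e' := drop_append_append hql.ge (u ++ q) v
        rw [← List.append_assoc, List.append_assoc u, ← hp] at e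
        rw [← List.append_assoc, List.append_assoc u, ← hq] at e'
        rw [e, e', h2]
      · exact (hf x hx).trans (by rw [h1, h2, h3]; exact (hf y hy).symm)
  have hfin : (Set.range τ).Finite := by
    have h1 : {l : List A | l.length ≤ k}.Finite := List.finite_length_le A k
    refine (h1.prod (h1.prod h1.powerset)).subset ?_
    rintro _ ⟨x, rfl⟩
    refine ⟨by simp [τ], by simp [τ]; omega, fun w hw => hw.1.le⟩
  have : Finite (Set.range τ) := hfin
  refine Finite.of_surjective
    (fun t : Set.range τ => Quotient.mk (synSetoid L) t.2.choose) ?_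
  intro q
  induction q using Quotient.inductionOn with
  | h x =>
    refine ⟨⟨τ x, x, rfl⟩, Quotient.sound (hτ _ _ ?_)⟩
    exact Exists.choose_spec (⟨x, rfl⟩ : ∃ y, τ y = τ x)

end Syntactic

end LocalTestability

/-- a language `L` over a finite alphabet is locally testable iff its syntactic
congruence has finitely many classes and its syntactic semigroup is a local semilattice:
for all nonempty words `e, x, y` with `ee ≈_L e`, one has `(exe)(exe) ≈_L exe` and
`(exe)(eye) ≈_L (eye)(exe)`. -/
theorem locally_testable_iff_local_semilattice {A : Type} [Fintype A] (L : Set (List A)) :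
    LocallyTestable L ↔
      Finite (Quotient (synSetoid L)) ∧
      ∀ e x y : List A, e ≠ [] → x ≠ [] → y ≠ [] → SynRel L (e ++ e) e →
        SynRel L ((e ++ x ++ e) ++ (e ++ x ++ e)) (e ++ x ++ e) ∧
        SynRel L ((e ++ x ++ e) ++ (e ++ y ++ e)) ((e ++ y ++ e) ++ (e ++ x ++ e)) := by
  exact ⟨fun h => ⟨LocalTestability.finite_quotient_of_locallyTestable h,
      fun _ x y he _ _ hee =>
        LocalTestability.localSemilattice_of_locallyTestable h x y he hee⟩,
    fun h => LocalTestability.locallyTestable_of_localSemilattice h.1 h.2⟩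
end

section
/- (Suschkewitsch's theorem) Let S be a finite nonempty semigroup. Then S has a least two-sided ideal K (a nonempty subset K with SK ⊆ K and KS ⊆ K contained in every nonempty two-sided ideal of S); K is simple, i.e., for every a ∈ K one has K = {a} ∪ aS ∪ Sa ∪ SaS; and every element of K lies in a subgroup of S contained in K: for every a ∈ K there exist e, b ∈ K with e·e = e, e·a = a, a·e = a, a·b = e, and b·a = e. -/
/-- A two-sided ideal of a semigroup: a nonempty subset `K` with `SK ⊆ K` and `KS ⊆ K`. -/
def IsTwoSidedIdeal {S : Type} [Semigroup S] (K : Set S) : Prop :=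
  K.Nonempty ∧ ∀ s : S, ∀ k ∈ K, s * k ∈ K ∧ k * s ∈ K

/-- A nonempty multiplicatively closed subset of a finite semigroup contains an idempotent. -/
theorem exists_idempotent_mem_of_mul_mem {S : Type*} [Semigroup S] [Finite S] {T : Set S}
    (hT : T.Nonempty) (hmul : ∀ x ∈ T, ∀ y ∈ T, x * y ∈ T) : ∃ e ∈ T, e * e = e := by
  let _ : TopologicalSpace S := ⊥
  have : DiscreteTopology S := ⟨rfl⟩
  exact exists_idempotent_in_compact_subsemigroup (fun _ => continuous_of_discreteTopology)
    T hT T.toFinite.isCompact hmul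

/-- In a finite semigroup, `a ∈ S a² S` implies `a ∈ a² S`. -/
theorem exists_eq_mul_self_mul {S : Type*} [Semigroup S] [Finite S] {a s t : S}
    (h : s * (a * a) * t = a) : ∃ u, a * a * u = a := by
  obtain ⟨f, ⟨⟨u, rfl⟩, r, hr⟩, hf⟩ := exists_idempotent_mem_of_mul_mem
    (T := {w : S | (∃ u, w = a * u) ∧ ∃ r, r * a * w = a})
    ⟨a * t, ⟨t, rfl⟩, s, by simpa only [mul_assoc] using h⟩ (by
      rintro _ ⟨⟨u, rfl⟩, r, hr⟩ w ⟨-, q, hq⟩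
      refine ⟨⟨u * w, mul_assoc _ _ _⟩, q * r, ?_⟩
      calc q * r * a * (a * u * w) = q * (r * a * (a * u)) * w := by simp only [mul_assoc]
        _ = a := by rw [hr, hq])
  refine ⟨u, ?_⟩
  calc a * a * u = r * a * (a * u) * (a * u) := by rw [hr, mul_assoc]
    _ = a := by rw [mul_assoc (r * a), hf, hr]

/-- In a finite semigroup, `a ∈ S a² S` implies `a ∈ S a²`. -/
theorem exists_eq_mul_mul_self {S : Type*} [Semigroup S] [Finite S] {a s t : S}
    (h : s * (a * a) * t = a) : ∃ v, v * (a * a) = a := by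
  have : Finite Sᵐᵒᵖ := .of_equiv S MulOpposite.opEquiv
  obtain ⟨u, hu⟩ := exists_eq_mul_self_mul (S := Sᵐᵒᵖ) (a := .op a) (s := .op t) (t := .op s)
    (by simp only [← MulOpposite.op_mul, ← mul_assoc] at h ⊢; rw [h])
  exact ⟨u.unop, congrArg MulOpposite.unop hu⟩

/-- A finite nonempty semigroup has a least two-sided ideal. -/
theorem exists_least_isTwoSidedIdeal (S : Type) [Semigroup S] [Finite S] [Nonempty S] :
    ∃ K : Set S, IsTwoSidedIdeal K ∧ ∀ I : Set S, IsTwoSidedIdeal I → K ⊆ I := by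
  obtain ⟨K, hK⟩ := {K : Set S | IsTwoSidedIdeal K}.toFinite.exists_minimal
    ⟨Set.univ, Set.univ_nonempty, fun _ _ _ => ⟨trivial, trivial⟩⟩
  have hKi : IsTwoSidedIdeal K := hK.prop
  refine ⟨K, hKi, fun I hI => ?_⟩
  obtain ⟨k, hk⟩ := hKi.1
  obtain ⟨i, hi⟩ := hI.1
  have hKI : IsTwoSidedIdeal (K ∩ I) :=
    ⟨⟨k * i, (hKi.2 i k hk).2, (hI.2 k i hi).1⟩, fun s x hx =>
      ⟨⟨(hKi.2 s x hx.1).1, (hI.2 s x hx.2).1⟩, ⟨(hKi.2 s x hx.1).2, (hI.2 s x hx.2).2⟩⟩⟩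
  exact (hK.le_of_le hKI Set.inter_subset_left).trans Set.inter_subset_right

theorem isTwoSidedIdeal_mul_mul {S : Type} [Semigroup S] (a : S) :
    IsTwoSidedIdeal {x : S | ∃ s t : S, x = s * a * t} := by
  refine ⟨⟨a * a * a, a, a, rfl⟩, ?_⟩
  rintro r _ ⟨s, t, rfl⟩
  exact ⟨⟨r * s, t, by simp only [mul_assoc]⟩, ⟨s, t * r, by simp only [mul_assoc]⟩⟩

/-- Suschkewitsch's theorem: every finite nonempty semigroup `S` has a least
two-sided ideal `K`; `K` is simple (`K = {a} ∪ aS ∪ Sa ∪ SaS` for every `a ∈ K`); and every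
element of `K` lies in a subgroup of `S` contained in `K`. -/
theorem suschkewitsch (S : Type) [Semigroup S] [Finite S] [Nonempty S] :
    ∃ K : Set S,
      IsTwoSidedIdeal K ∧
      (∀ I : Set S, IsTwoSidedIdeal I → K ⊆ I) ∧
      (∀ a ∈ K, K = {a} ∪ {x | ∃ s : S, x = a * s} ∪ {x | ∃ s : S, x = s * a}
        ∪ {x | ∃ s t : S, x = s * a * t}) ∧
      (∀ a ∈ K, ∃ e b : S, e ∈ K ∧ b ∈ K ∧
        e * e = e ∧ e * a = a ∧ a * e = a ∧ a * b = e ∧ b * a = e) := by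
  obtain ⟨K, hK, hleast⟩ := exists_least_isTwoSidedIdeal S
  refine ⟨K, hK, hleast, fun a ha => ?_, fun a ha => ?_⟩
  · refine Set.Subset.antisymm
      ((hleast _ (isTwoSidedIdeal_mul_mul a)).trans Set.subset_union_right) ?_
    rintro _ (((rfl | ⟨s, rfl⟩) | ⟨s, rfl⟩) | ⟨s, t, rfl⟩)
    · exact ha
    · exact (hK.2 s a ha).2
    · exact (hK.2 s a ha).1
    · exact (hK.2 t _ (hK.2 s a ha).1).2
  · obtain ⟨s, t, hst⟩ := hleast _ (isTwoSidedIdeal_mul_mul (a * a)) ha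
    obtain ⟨u, hu⟩ := exists_eq_mul_self_mul hst.symm
    obtain ⟨v, hv⟩ := exists_eq_mul_mul_self hst.symm
    have he : v * a = a * u := by
      calc v * a = v * (a * a) * u := by rw [mul_assoc, hu]
        _ = a * u := by rw [hv]
    have hae : a * (a * u) = a := by rw [← mul_assoc, hu]
    have hea : a * u * a = a := by rw [← he, mul_assoc, hv]
    refine ⟨a * u, v * a * u, (hK.2 u a ha).2, (hK.2 u _ (hK.2 v a ha).1).2,
      by rw [← mul_assoc, hea], hea, hae, ?_, ?_⟩
    · rw [he, ← mul_assoc, hae]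
    · rw [mul_assoc v, mul_assoc v, hea, he]
end

section
/- (Clifford's theorem, finite case) Let S be a finite semigroup in which every element lies in a subgroup: for every a ∈ S there exist e, b ∈ S with e·e = e, e·a = a·e = a, e·b = b·e = b, and a·b = b·a = e. Then there exist a finite commutative semigroup E in which every element is idempotent (a semilattice) and a surjective semigroup homomorphism φ : S → E such that for every ε ∈ E the fiber φ⁻¹(ε) is a subsemigroup of S which is simple: for all a, c ∈ φ⁻¹(ε) there exist x, y ∈ φ⁻¹(ε) with x·a·y = c. -/
section JOrder

variable {S : Type*} [Semigroup S]

/-- Every element lies in a subgroup. -/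
def IsCompletelyRegular (S : Type*) [Semigroup S] : Prop :=
  ∀ a : S, ∃ e b : S, e * e = e ∧ e * a = a ∧ a * e = a ∧
    e * b = b ∧ b * e = b ∧ a * b = e ∧ b * a = e

/-- The element `a` lies in the set `S * b * S`. In a completely regular semigroup this is the
preorder attached to Green's relation `J`. -/
def JLe (a b : S) : Prop := ∃ x y : S, x * b * y = a

theorem JLe.trans {a b c : S} (hab : JLe a b) (hbc : JLe b c) : JLe a c := by
  obtain ⟨x, y, rfl⟩ := hab
  obtain ⟨u, v, rfl⟩ := hbc
  exact ⟨x * u, v * y, by simp only [mul_assoc]⟩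

namespace IsCompletelyRegular

theorem jLe_refl (h : IsCompletelyRegular S) (a : S) : JLe a a := by
  obtain ⟨e, b, -, hea, hae, -⟩ := h a
  exact ⟨e, e, by rw [hea, hae]⟩

theorem mul_jLe_left (h : IsCompletelyRegular S) (a b : S) : JLe (a * b) a := by
  obtain ⟨e, -, -, hea, -⟩ := h a
  exact ⟨e, b, by rw [hea]⟩

theorem mul_jLe_right (h : IsCompletelyRegular S) (a b : S) : JLe (a * b) b := by
  obtain ⟨e, -, -, -, hbe, -⟩ := h b
  exact ⟨a, e, by rw [mul_assoc, hbe]⟩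

theorem jLe_mul_self (h : IsCompletelyRegular S) (a : S) : JLe a (a * a) := by
  obtain ⟨e, b, -, hea, hae, -, -, -, hba⟩ := h a
  exact ⟨b, e, by rw [← mul_assoc, hba, hea, hae]⟩

theorem mul_jLe_mul_comm (h : IsCompletelyRegular S) (a b : S) : JLe (a * b) (b * a) :=
  (h.jLe_mul_self (a * b)).trans ⟨a, b, by simp only [mul_assoc]⟩

theorem jLe_mul (h : IsCompletelyRegular S) {a b c : S} (ha : JLe c a) (hb : JLe c b) :
    JLe c (a * b) := by
  have hc := h.jLe_mul_self c
  obtain ⟨x, y, hxy⟩ := ha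
  obtain ⟨u, v, huv⟩ := hb
  have hbva : JLe (c * c) (b * (v * x * a)) :=
    ⟨u, y, by nth_rw 1 [← huv]; rw [← hxy]; simp only [mul_assoc]⟩
  have hab : JLe (v * x * a * b) (a * b) := by
    rw [mul_assoc]
    exact h.mul_jLe_right (v * x) (a * b)
  exact hc.trans (hbva.trans ((h.mul_jLe_mul_comm _ _).trans hab))

theorem mul_jLe_mul (h : IsCompletelyRegular S) {a b c d : S} (hab : JLe a b) (hcd : JLe c d) :
    JLe (a * c) (b * d) :=
  h.jLe_mul ((h.mul_jLe_left a c).trans hab) ((h.mul_jLe_right a c).trans hcd)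

/-- Green's relation `J` on a completely regular semigroup. -/
def jSetoid (h : IsCompletelyRegular S) : Setoid S where
  r a b := JLe a b ∧ JLe b a
  iseqv :=
    { refl := fun a => ⟨h.jLe_refl a, h.jLe_refl a⟩
      symm := fun hab => ⟨hab.2, hab.1⟩
      trans := fun hab hbc => ⟨hab.1.trans hbc.1, hbc.2.trans hab.2⟩ }

/-- The multipliers witnessing `JLe c a` can be chosen in the `J`-class of `c`. -/
theorem exists_mul_mul_eq (h : IsCompletelyRegular S) {a c : S} (hca : JLe c a) :
    ∃ x y : S, h.jSetoid x c ∧ h.jSetoid y c ∧ x * a * y = c := by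
  obtain ⟨x, y, hxy⟩ := hca
  obtain ⟨f, d, -, hfc, hcf, -, -, hcd, -⟩ := h c
  have hf : JLe f c := hcd ▸ h.mul_jLe_left c d
  have heq : f * x * a * (y * f) = c := by
    calc f * x * a * (y * f) = f * (x * a * y) * f := by simp only [mul_assoc]
      _ = c := by rw [hxy, hfc, hcf]
  refine ⟨f * x, y * f, ⟨(h.mul_jLe_left f x).trans hf, ?_⟩,
    ⟨(h.mul_jLe_right y f).trans hf, ?_⟩, heq⟩
  · have hle := h.mul_jLe_left (f * x) (a * (y * f))
    rwa [← mul_assoc, heq] at hle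
  · have hle := h.mul_jLe_right (f * x * a) (y * f)
    rwa [heq] at hle

end IsCompletelyRegular

end JOrder

/-- Clifford's theorem, finite case: if every element of a finite semigroup
`S` lies in a subgroup, then there is a surjective homomorphism `φ` from `S` onto a finite
semilattice `E` (a finite commutative idempotent semigroup) all of whose fibers are simple
subsemigroups of `S`. -/
theorem clifford_finite (S : Type) [Semigroup S] [Finite S]
    (hcr : ∀ a : S, ∃ e b : S, e * e = e ∧ e * a = a ∧ a * e = a ∧
      e * b = b ∧ b * e = b ∧ a * b = e ∧ b * a = e) :
    ∃ (E : Type), Finite E ∧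
      ∃ mul : E → E → E,
        (∀ x y z : E, mul (mul x y) z = mul x (mul y z)) ∧
        (∀ x y : E, mul x y = mul y x) ∧
        (∀ x : E, mul x x = x) ∧
        ∃ φ : S → E, Function.Surjective φ ∧
          (∀ a b : S, φ (a * b) = mul (φ a) (φ b)) ∧
          (∀ (ε : E) (a c : S), φ a = ε → φ c = ε →
            ∃ x y : S, φ x = ε ∧ φ y = ε ∧ x * a * y = c) := by
  have h : IsCompletelyRegular S := hcr
  refine ⟨Quotient h.jSetoid, inferInstance,
    Quotient.map₂ (· * ·) fun _ _ hab _ _ hcd =>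
      ⟨h.mul_jLe_mul hab.1 hcd.1, h.mul_jLe_mul hab.2 hcd.2⟩,
    ?_, ?_, ?_, Quotient.mk h.jSetoid, Quotient.mk_surjective, fun _ _ => rfl, ?_⟩
  · rintro ⟨a⟩ ⟨b⟩ ⟨c⟩
    exact congrArg (Quotient.mk h.jSetoid) (mul_assoc a b c)
  · rintro ⟨a⟩ ⟨b⟩
    exact Quotient.sound ⟨h.mul_jLe_mul_comm a b, h.mul_jLe_mul_comm b a⟩
  · rintro ⟨a⟩
    exact Quotient.sound ⟨h.mul_jLe_left a a, h.jLe_mul_self a⟩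
  · rintro _ a c ha rfl
    obtain ⟨x, y, hx, hy, hxy⟩ := h.exists_mul_mul_eq (Quotient.exact ha).2
    exact ⟨x, y, Quotient.sound hx, Quotient.sound hy, hxy⟩
end

section
/- (D = J in finite semigroups) Let M be a finite monoid and a, b ∈ M. If a and b generate the same two-sided principal ideal, i.e., {u·a·v | u, v ∈ M} = {u·b·v | u, v ∈ M}, then there exists c ∈ M with a·M = c·M and M·c = M·b (i.e., a and b are D-equivalent: a is R-equivalent to some c which is L-equivalent to b). -/
theorem eq_pow_mul_mul_pow {M : Type*} [Monoid M] {a p q : M} (h : a = p * a * q) (n : ℕ) :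
    a = p ^ n * a * q ^ n := by
  induction n with
  | zero => simp
  | succ n ih =>
    calc a = p ^ n * (p * a * q) * q ^ n := by rw [← h]; exact ih
      _ = p ^ (n + 1) * a * q ^ (n + 1) := by
        rw [pow_succ p, pow_succ' q]
        simp only [mul_assoc]

theorem exists_pow_eq_pow_add_succ {M : Type*} [Monoid M] [Finite M] (q : M) :
    ∃ i k : ℕ, q ^ i = q ^ (i + (k + 1)) := by
  obtain ⟨i, j, hij, h⟩ := Finite.exists_ne_map_eq_of_infinite (fun n : ℕ => q ^ n)
  rcases lt_or_gt_of_ne hij with hlt | hlt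
  · obtain ⟨k, rfl⟩ := Nat.exists_eq_add_of_lt hlt
    exact ⟨i, k, h⟩
  · obtain ⟨k, rfl⟩ := Nat.exists_eq_add_of_lt hlt
    exact ⟨j, k, h.symm⟩

theorem exists_eq_mul_pow_succ {M : Type*} [Monoid M] [Finite M] {a p q : M}
    (h : a = p * a * q) : ∃ k : ℕ, a = a * q ^ (k + 1) := by
  obtain ⟨i, k, hik⟩ := exists_pow_eq_pow_add_succ q
  refine ⟨k, ?_⟩
  have ha := eq_pow_mul_mul_pow h i
  calc a = p ^ i * a * q ^ (i + (k + 1)) := by rw [← hik]; exact ha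
    _ = p ^ i * a * q ^ i * q ^ (k + 1) := by rw [pow_add, mul_assoc (p ^ i * a)]
    _ = a * q ^ (k + 1) := by rw [← ha]

theorem exists_eq_pow_succ_mul {M : Type*} [Monoid M] [Finite M] {a p q : M}
    (h : a = p * a * q) : ∃ k : ℕ, a = p ^ (k + 1) * a := by
  obtain ⟨i, k, hik⟩ := exists_pow_eq_pow_add_succ p
  refine ⟨k, ?_⟩
  have ha := eq_pow_mul_mul_pow h i
  calc a = p ^ (i + (k + 1)) * a * q ^ i := by rw [← hik]; exact ha
    _ = p ^ (k + 1) * (p ^ i * a * q ^ i) := by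
      rw [add_comm i, pow_add]
      simp only [mul_assoc]
    _ = p ^ (k + 1) * a := by rw [← ha]

/-- `D = J` in finite monoids: in a finite monoid, if `a` and `b` generate the
same two-sided principal ideal then there is `c` with `aM = cM` and `Mc = Mb`, i.e. `a` and
`b` are `D`-equivalent. -/
theorem D_eq_J_finite (M : Type) [Monoid M] [Finite M] (a b : M)
    (hJ : {x : M | ∃ u v : M, x = u * a * v} = {x : M | ∃ u v : M, x = u * b * v}) :
    ∃ c : M, {x : M | ∃ m : M, x = a * m} = {x : M | ∃ m : M, x = c * m} ∧
      {x : M | ∃ m : M, x = m * c} = {x : M | ∃ m : M, x = m * b} := by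
  obtain ⟨u, v, hu⟩ : a ∈ {x : M | ∃ u v : M, x = u * b * v} := hJ ▸ ⟨1, 1, by simp⟩
  obtain ⟨s, t, hs⟩ : b ∈ {x : M | ∃ u v : M, x = u * a * v} := hJ ▸ ⟨1, 1, by simp⟩
  have h : a = (u * s) * a * (t * v) := by
    calc a = u * (s * a * t) * v := by rw [← hs]; exact hu
      _ = (u * s) * a * (t * v) := by simp only [mul_assoc]
  obtain ⟨k, hk⟩ := exists_eq_mul_pow_succ h
  obtain ⟨l, hl⟩ := exists_eq_pow_succ_mul h
  have hat : a = a * t * (v * (t * v) ^ k) := by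
    rw [pow_succ'] at hk
    simpa only [mul_assoc] using hk
  have hbt : a * t = (u * s) ^ l * u * b := by
    calc a * t = (u * s) ^ (l + 1) * a * t := by rw [← hl]
      _ = (u * s) ^ l * u * (s * a * t) := by rw [pow_succ]; simp only [mul_assoc]
      _ = (u * s) ^ l * u * b := by rw [← hs]
  refine ⟨a * t, Set.ext fun x => ⟨?_, ?_⟩, Set.ext fun x => ⟨?_, ?_⟩⟩
  · rintro ⟨m, rfl⟩
    exact ⟨v * (t * v) ^ k * m, by rw [← mul_assoc, ← hat]⟩
  · rintro ⟨m, rfl⟩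
    exact ⟨t * m, mul_assoc _ _ _⟩
  · rintro ⟨m, rfl⟩
    exact ⟨m * ((u * s) ^ l * u), by rw [hbt, ← mul_assoc m]⟩
  · rintro ⟨m, rfl⟩
    exact ⟨m * s, by rw [hs]; simp only [mul_assoc]⟩
end

section
/- (Rees's theorem, finite case) Let S be a finite semigroup with a zero element z (z·x = x·z = z for all x ∈ S) such that S·S ≠ {z} and S is 0-simple: for every a ∈ S with a ≠ z, the set {a} ∪ aS ∪ Sa ∪ SaS equals S. Then there exist a finite group G, finite nonempty index sets I and Λ, and a sandwich matrix P : Λ → I → Option G in which every row and every column has a nonzero entry (for every λ ∈ Λ there is i ∈ I with P λ i ≠ none, and for every i ∈ I there is λ ∈ Λ with P λ i ≠ none), such that S is isomorphic as a semigroup to the Rees matrix semigroup M⁰(G; I, Λ; P). -/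
/-- A bundled group. -/
structure BGrp where
  carrier : Type
  [grp : Group carrier]

attribute [instance] BGrp.grp

/-- Multiplication of the Rees matrix semigroup with zero `M⁰(G; I, Λ; P)` on the set
`Option (I × G × Λ)` (with `none` the zero), for a sandwich matrix `P : Λ → I → Option G`. -/
def reesMul {G I Λ : Type} [Group G] (P : Λ → I → Option G) :
    Option (I × G × Λ) → Option (I × G × Λ) → Option (I × G × Λ)
  | some (i, g, l), some (j, h, m) =>
      match P l j with
      | some p => some (i, g * p * h, m)
      | none => none
  | _, _ => none

section ReesTheorem

variable {S : Type} [Semigroup S] {z e : S}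

/-- In a non-null `0`-simple semigroup, every nonzero element `a` satisfies `S a S = S`. -/
lemma exists_eq_mul_mul_of_zeroSimple
    (hSS : {x : S | ∃ s t : S, x = s * t} ≠ {z})
    (h0simple : ∀ a : S, a ≠ z →
      ({a} ∪ {x | ∃ s : S, x = a * s} ∪ {x | ∃ s : S, x = s * a}
        ∪ {x | ∃ s t : S, x = s * a * t}) = Set.univ)
    {a : S} (ha : a ≠ z) (x : S) : ∃ s t : S, x = s * a * t := by
  have hcases : ∀ b : S, b ≠ z → ∀ y : S,
      y = b ∨ (∃ s, y = b * s) ∨ (∃ s, y = s * b) ∨ ∃ s t, y = s * b * t := by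
    intro b hb y
    have := Set.mem_univ y
    rw [← h0simple b hb] at this
    simpa [or_assoc] using this
  obtain ⟨u, v, huv⟩ : ∃ u v : S, u * v ≠ z := by
    by_contra! h
    refine hSS (Set.ext fun y => ⟨?_, ?_⟩)
    · rintro ⟨s, t, rfl⟩
      exact h s t
    · rintro rfl
      exact ⟨y, y, (h y y).symm⟩
  have hsq : ∀ y : S, ∃ s t : S, y = s * t := by
    intro y
    rcases hcases _ huv y with h | ⟨s, h⟩ | ⟨s, h⟩ | ⟨s, t, h⟩
    exacts [⟨_, _, h⟩, ⟨_, _, h⟩, ⟨_, _, h⟩, ⟨_, _, h⟩]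
  obtain ⟨x₁, x₂, rfl⟩ := hsq x
  obtain ⟨x₂, x₃, rfl⟩ := hsq x₂
  rcases hcases a ha x₂ with rfl | ⟨s, rfl⟩ | ⟨s, rfl⟩ | ⟨s, t, rfl⟩
  · exact ⟨x₁, x₃, by simp only [mul_assoc]⟩
  · exact ⟨x₁, s * x₃, by simp only [mul_assoc]⟩
  · exact ⟨x₁ * s, x₃, by simp only [mul_assoc]⟩
  · exact ⟨x₁ * s, t * x₃, by simp only [mul_assoc]⟩

/-- A finite semigroup with `a ∈ S a S` for some nonzero `a` has a nonzero idempotent. -/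
lemma exists_idempotent_ne_zero [Finite S] (hz : ∀ x : S, z * x = z ∧ x * z = z)
    {a : S} (ha : a ≠ z) (h : ∃ s t : S, a = s * a * t) : ∃ e : S, e ≠ z ∧ e * e = e := by
  let : TopologicalSpace S := ⊥
  have : DiscreteTopology S := ⟨rfl⟩
  obtain ⟨e, ⟨t, ht⟩, he⟩ := exists_idempotent_in_compact_subsemigroup
    (fun r : S => continuous_of_discreteTopology) {s : S | ∃ t, a = s * a * t} h
    (Set.toFinite _).isCompact (by
      rintro s ⟨t, ht⟩ s' ⟨t', ht'⟩
      refine ⟨t' * t, ?_⟩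
      calc a = s * a * t := ht
        _ = s * (s' * a * t') * t := by rw [← ht']
        _ = s * s' * a * (t' * t) := by simp only [mul_assoc])
  refine ⟨e, ?_, he⟩
  rintro rfl
  exact ha (by rw [ht, (hz a).1, (hz t).1])

/-- In a finite `0`-simple semigroup, the nonzero elements of `e S e`, for `e` a nonzero
idempotent, form a group with identity `e`. -/
lemma exists_group_corner [Finite S] (hsimple : ∀ a : S, a ≠ z → ∀ x, ∃ s t : S, x = s * a * t)
    (he : e * e = e) :
    ∃ (G : BGrp) (φ : G.carrier →ₙ* S), Finite G.carrier ∧ Function.Injective φ ∧ φ 1 = e ∧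
      ∀ a, e * a = a → a * e = a → a ≠ z → ∃ g, φ g = a := by
  let M : Type := {a : S // e * a = a ∧ a * e = a}
  let : Monoid M :=
    { mul := fun a b => ⟨a.1 * b.1, by rw [← mul_assoc, a.2.1], by rw [mul_assoc, b.2.2]⟩
      mul_assoc := fun a b c => Subtype.ext (mul_assoc a.1 b.1 c.1)
      one := ⟨e, he, he⟩
      one_mul := fun a => Subtype.ext a.2.1
      mul_one := fun a => Subtype.ext a.2.2 }
  have : Finite M := inferInstanceAs (Finite {a : S // e * a = a ∧ a * e = a})
  refine ⟨⟨Mˣ⟩, ⟨fun g => g.val.val, fun _ _ => rfl⟩, inferInstanceAs (Finite Mˣ),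
    fun g h hgh => Units.ext (Subtype.ext hgh), rfl, fun a hea hae haz => ?_⟩
  obtain ⟨s, t, hst⟩ := hsimple a haz e
  let s' : M := ⟨e * s * e, by simp only [← mul_assoc, he], by simp only [mul_assoc, he]⟩
  let t' : M := ⟨e * t * e, by simp only [← mul_assoc, he], by simp only [mul_assoc, he]⟩
  let a' : M := ⟨a, hea, hae⟩
  have h : s' * (a' * t') = 1 := Subtype.ext <| by
    change e * s * e * (a * (e * t * e)) = e
    calc e * s * e * (a * (e * t * e)) = e * (s * ((e * a) * e) * t) * e := by
          simp only [mul_assoc]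
      _ = e := by rw [hea, hae, ← hst, he, he]
  have h' : a' * (t' * s') = 1 := by rw [← mul_assoc]; exact mul_eq_one_symm h
  exact ⟨(IsUnit.of_mul_eq_one _ h').unit, rfl⟩

variable {G : Type} [Group G] (φ : G →ₙ* S)

/-- The orbits of the right multiplication action of `G` on the nonzero elements of `S e`
admit a system of representatives. -/
lemma exists_right_transversal [Finite S] (he : φ 1 = e) :
    ∃ (I : Type) (r : I → S), Finite I ∧ (∀ i, r i ≠ z) ∧ (∀ i, r i * e = r i) ∧
      (∀ x, x ≠ z → x * e = x → ∃ i g, x = r i * φ g) ∧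
      ∀ i j g, r i = r j * φ g → i = j := by
  let X : Type := {x : S // x ≠ z ∧ x * e = x}
  let σ : Setoid X :=
    { r := fun x y => ∃ g, x.1 = y.1 * φ g
      iseqv :=
        { refl := fun x => ⟨1, by rw [he, x.2.2]⟩
          symm := by
            rintro x y ⟨g, h⟩
            exact ⟨g⁻¹, by rw [h, mul_assoc, ← map_mul, mul_inv_cancel, he, y.2.2]⟩
          trans := by
            rintro x y w ⟨g, h⟩ ⟨k, h'⟩
            exact ⟨k * g, by rw [h, h', map_mul, mul_assoc]⟩ } }
  have : Finite X := inferInstanceAs (Finite {x : S // x ≠ z ∧ x * e = x})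
  refine ⟨Quotient σ, fun i => i.out.1, inferInstance, fun i => i.out.2.1, fun i => i.out.2.2,
    fun x hx hxe => ?_, fun i j g h => ?_⟩
  · exact ⟨⟦⟨x, hx, hxe⟩⟧, σ.symm (Quotient.mk_out (s := σ) ⟨x, hx, hxe⟩)⟩
  · exact Quotient.out_equiv_out.mp ⟨g, h⟩

/-- The orbits of the left multiplication action of `G` on the nonzero elements of `e S`
admit a system of representatives. -/
lemma exists_left_transversal [Finite S] (he : φ 1 = e) :
    ∃ (Λ : Type) (q : Λ → S), Finite Λ ∧ (∀ l, q l ≠ z) ∧ (∀ l, e * q l = q l) ∧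
      (∀ x, x ≠ z → e * x = x → ∃ l g, x = φ g * q l) ∧
      ∀ l m g, q l = φ g * q m → l = m := by
  let X : Type := {x : S // x ≠ z ∧ e * x = x}
  let σ : Setoid X :=
    { r := fun x y => ∃ g, x.1 = φ g * y.1
      iseqv :=
        { refl := fun x => ⟨1, by rw [he, x.2.2]⟩
          symm := by
            rintro x y ⟨g, h⟩
            exact ⟨g⁻¹, by rw [h, ← mul_assoc, ← map_mul, inv_mul_cancel, he, y.2.2]⟩
          trans := by
            rintro x y w ⟨g, h⟩ ⟨k, h'⟩
            exact ⟨g * k, by rw [h, h', map_mul, mul_assoc]⟩ } }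
  have : Finite X := inferInstanceAs (Finite {x : S // x ≠ z ∧ e * x = x})
  refine ⟨Quotient σ, fun l => l.out.1, inferInstance, fun l => l.out.2.1, fun l => l.out.2.2,
    fun x hx hxe => ?_, fun l m g h => ?_⟩
  · exact ⟨⟦⟨x, hx, hxe⟩⟧, σ.symm (Quotient.mk_out (s := σ) ⟨x, hx, hxe⟩)⟩
  · exact Quotient.out_equiv_out.mp ⟨g, h⟩

variable {φ}

/-- Every nonzero `x ∈ S e` has a left inverse relative to `e`, lying in `e S`. -/
lemma exists_mul_eq_of_mul_idempotent (hz : ∀ x : S, z * x = z ∧ x * z = z)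
    (hsimple : ∀ a : S, a ≠ z → ∀ x, ∃ s t : S, x = s * a * t)
    (hez : e ≠ z) (he : φ 1 = e) (hφ : ∀ a, e * a = a → a * e = a → a ≠ z → ∃ g, φ g = a)
    {x : S} (hx : x ≠ z) (hxe : x * e = x) : ∃ y, e * y = y ∧ y * x = e := by
  have hee : e * e = e := by rw [← he, ← map_mul, one_mul]
  obtain ⟨s, t, hst⟩ := hsimple x hx e
  obtain ⟨g, hg⟩ := hφ (e * s * x) (by simp only [← mul_assoc, hee])
    (by rw [mul_assoc, hxe]) (fun h => hez <| by
      calc e = e * (s * x * t) := by rw [← hst, hee]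
        _ = e * s * x * t := by simp only [mul_assoc]
        _ = z := by rw [h, (hz t).1])
  refine ⟨φ g⁻¹ * (e * s), ?_, ?_⟩
  · rw [← mul_assoc, ← he, ← map_mul, one_mul]
  · rw [mul_assoc, ← hg, ← map_mul, inv_mul_cancel, he]

/-- Every nonzero `x ∈ e S` has a right inverse relative to `e`, lying in `S e`. -/
lemma exists_mul_eq_of_idempotent_mul (hz : ∀ x : S, z * x = z ∧ x * z = z)
    (hsimple : ∀ a : S, a ≠ z → ∀ x, ∃ s t : S, x = s * a * t)
    (hez : e ≠ z) (he : φ 1 = e) (hφ : ∀ a, e * a = a → a * e = a → a ≠ z → ∃ g, φ g = a)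
    {x : S} (hx : x ≠ z) (hex : e * x = x) : ∃ y, y * e = y ∧ x * y = e := by
  have hee : e * e = e := by rw [← he, ← map_mul, one_mul]
  obtain ⟨s, t, hst⟩ := hsimple x hx e
  obtain ⟨g, hg⟩ := hφ (x * (t * e)) (by rw [← mul_assoc, hex])
    (by simp only [mul_assoc, hee]) (fun h => hez <| by
      calc e = (s * x * t) * e := by rw [← hst, hee]
        _ = s * (x * (t * e)) := by simp only [mul_assoc]
        _ = z := by rw [h, (hz s).2])
  refine ⟨t * e * φ g⁻¹, ?_, ?_⟩
  · rw [mul_assoc, ← he, ← map_mul, mul_one]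
  · rw [← mul_assoc, ← hg, ← map_mul, mul_inv_cancel, he]

/-- The map `M⁰(G; I, Λ; P) → S` sending `(i, g, λ)` to `r i * φ g * q λ` and zero to `z`. -/
def reesMap {I Λ : Type} (z : S) (φ : G →ₙ* S) (r : I → S) (q : Λ → S) :
    Option (I × G × Λ) → S
  | some (i, g, l) => r i * φ g * q l
  | none => z

lemma reesMap_reesMul {I Λ : Type} (hz : ∀ x : S, z * x = z ∧ x * z = z) {r : I → S} {q : Λ → S}
    {P : Λ → I → Option G}
    (hP : ∀ l i, (P l i = none ∧ q l * r i = z) ∨ ∃ g, P l i = some g ∧ q l * r i = φ g)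
    (x y : Option (I × G × Λ)) :
    reesMap z φ r q (reesMul P x y) = reesMap z φ r q x * reesMap z φ r q y := by
  rcases x with _ | ⟨i, g, l⟩
  · simp [reesMap, reesMul, (hz _).1]
  rcases y with _ | ⟨j, h, m⟩
  · simp [reesMap, reesMul, (hz _).2]
  have key : reesMap z φ r q (some (i, g, l)) * reesMap z φ r q (some (j, h, m)) =
      r i * φ g * (q l * r j) * φ h * q m := by
    simp only [reesMap, mul_assoc]
  rw [key]
  rcases hP l j with ⟨hn, hqr⟩ | ⟨p, hp, hqr⟩
  · simp [reesMap, reesMul, hn, hqr, (hz _).1, (hz _).2]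
  · simp [reesMap, reesMul, hp, hqr, mul_assoc]

end ReesTheorem

/-- Rees's theorem, finite case: every finite 0-simple semigroup `S` with
`S·S ≠ {z}` is isomorphic to a regular Rees matrix semigroup with zero `M⁰(G; I, Λ; P)` over
a finite group `G`, with finite nonempty index sets and a sandwich matrix each of whose rows
and columns contains a nonzero entry. -/
theorem rees_theorem_finite (S : Type) [Semigroup S] [Finite S] (z : S)
    (hz : ∀ x : S, z * x = z ∧ x * z = z)
    (hSS : {x : S | ∃ s t : S, x = s * t} ≠ {z})
    (h0simple : ∀ a : S, a ≠ z →
      ({a} ∪ {x | ∃ s : S, x = a * s} ∪ {x | ∃ s : S, x = s * a}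
        ∪ {x | ∃ s t : S, x = s * a * t}) = Set.univ) :
    ∃ (G : BGrp) (I Λ : Type), Finite G.carrier ∧
      Finite I ∧ Nonempty I ∧ Finite Λ ∧ Nonempty Λ ∧
      ∃ P : Λ → I → Option G.carrier,
        (∀ l : Λ, ∃ i : I, P l i ≠ none) ∧
        (∀ i : I, ∃ l : Λ, P l i ≠ none) ∧
        ∃ e : S ≃ Option (I × G.carrier × Λ),
          ∀ x y : S, e (x * y) = reesMul P (e x) (e y) := by
  have hsimple : ∀ a : S, a ≠ z → ∀ x, ∃ s t : S, x = s * a * t := fun a ha x =>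
    exists_eq_mul_mul_of_zeroSimple hSS h0simple ha x
  obtain ⟨a, ha⟩ : ∃ a : S, a ≠ z := by
    by_contra! h
    exact hSS (Set.ext fun y => ⟨fun _ => h y, fun _ => ⟨z, z, by rw [h y, (hz z).1]⟩⟩)
  obtain ⟨e, hez, hee⟩ := exists_idempotent_ne_zero hz ha (hsimple a ha a)
  obtain ⟨G, φ, hG, hinj, he, hφ⟩ := exists_group_corner hsimple hee
  obtain ⟨I, r, hI, hrz, hre, hr, hr_unique⟩ := exists_right_transversal (z := z) φ he
  obtain ⟨Λ, q, hΛ, hqz, heq, hq, hq_unique⟩ := exists_left_transversal (z := z) φ he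
  have hφe : ∀ g, φ g * e = φ g := fun g => by rw [← he, ← map_mul, mul_one]
  have heφ : ∀ g, e * φ g = φ g := fun g => by rw [← he, ← map_mul, one_mul]
  have hφz : ∀ g, φ g ≠ z := fun g h => hez <| by
    rw [← he, ← mul_inv_cancel g, map_mul, h, (hz _).1]
  have hr_inv : ∀ i, ∃ y, e * y = y ∧ y * r i = e := fun i =>
    exists_mul_eq_of_mul_idempotent hz hsimple hez he hφ (hrz i) (hre i)
  have hq_inv : ∀ l, ∃ y, y * e = y ∧ q l * y = e := fun l =>
    exists_mul_eq_of_idempotent_mul hz hsimple hez he hφ (hqz l) (heq l)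
  have hP_exists : ∀ l i, ∃ o : Option G.carrier,
      (o = none ∧ q l * r i = z) ∨ ∃ g, o = some g ∧ q l * r i = φ g := by
    intro l i
    by_cases h : q l * r i = z
    · exact ⟨none, Or.inl ⟨rfl, h⟩⟩
    · obtain ⟨g, hg⟩ := hφ (q l * r i) (by rw [← mul_assoc, heq]) (by rw [mul_assoc, hre]) h
      exact ⟨some g, Or.inr ⟨g, rfl, hg.symm⟩⟩
  choose P hP using hP_exists
  have hP_ne : ∀ l i, q l * r i ≠ z → P l i ≠ none := by
    intro l i h hn
    rcases hP l i with ⟨-, h'⟩ | ⟨g, hg, -⟩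
    · exact h h'
    · simp [hn] at hg
  have hne : ∀ i g l, r i * φ g * q l ≠ z := by
    intro i g l h
    obtain ⟨y, -, hy⟩ := hr_inv i
    obtain ⟨w, -, hw⟩ := hq_inv l
    apply hφz g
    calc φ g = (y * r i) * φ g * (q l * w) := by rw [hy, hw, heφ, hφe]
      _ = y * (r i * φ g * q l) * w := by simp only [mul_assoc]
      _ = z := by rw [h, (hz _).2, (hz _).1]
  have hI_eq : ∀ i g l j h m, r i * φ g * q l = r j * φ h * q m → i = j := by
    intro i g l j h m heq'
    obtain ⟨w, hwe, hw⟩ := hq_inv l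
    have h₁ : r i * φ g = r j * (φ h * q m * w) := by
      calc r i * φ g = r i * φ g * q l * w := by rw [mul_assoc _ (q l), hw, mul_assoc, hφe]
        _ = r j * (φ h * q m * w) := by rw [heq']; simp only [mul_assoc]
    obtain ⟨k, hk⟩ := hφ (φ h * q m * w) (by simp only [← mul_assoc, heφ])
      (by rw [mul_assoc, hwe]) (fun hzero => by
        apply hne i g l
        rw [h₁, hzero, (hz _).2, (hz _).1])
    refine hr_unique i j (k * g⁻¹) ?_
    rw [map_mul, hk, ← mul_assoc, ← h₁, mul_assoc, ← map_mul, mul_inv_cancel, he, hre]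
  have hΛ_eq : ∀ i g l j h m, r i * φ g * q l = r j * φ h * q m → l = m := by
    intro i g l j h m heq'
    obtain ⟨y, hey, hy⟩ := hr_inv i
    have h₁ : φ g * q l = y * r j * φ h * q m := by
      calc φ g * q l = y * (r i * φ g * q l) := by
            rw [mul_assoc (r i), ← mul_assoc y, hy, ← mul_assoc, heφ]
        _ = y * r j * φ h * q m := by rw [heq']; simp only [mul_assoc]
    obtain ⟨k, hk⟩ := hφ (y * r j * φ h) (by simp only [← mul_assoc, hey])
      (by rw [mul_assoc, hφe]) (fun hzero => by
        apply hne i g l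
        rw [mul_assoc, h₁, hzero, (hz _).1, (hz _).2])
    refine hq_unique l m (g⁻¹ * k) ?_
    rw [map_mul, hk, mul_assoc, ← h₁, ← mul_assoc, ← map_mul, inv_mul_cancel, he, heq]
  have hbij : Function.Bijective (reesMap z φ r q) := by
    constructor
    · rintro (_ | ⟨i, g, l⟩) (_ | ⟨j, h, m⟩) hxy
      · rfl
      · exact absurd hxy.symm (hne j h m)
      · exact absurd hxy (hne i g l)
      · obtain rfl := hI_eq i g l j h m hxy
        obtain rfl := hΛ_eq i g l i h m hxy
        obtain ⟨y, -, hy⟩ := hr_inv i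
        obtain ⟨w, -, hw⟩ := hq_inv l
        have hcancel : ∀ k, y * reesMap z φ r q (some (i, k, l)) * w = φ k := fun k => by
          calc y * (r i * φ k * q l) * w = (y * r i) * φ k * (q l * w) := by
                simp only [mul_assoc]
            _ = φ k := by rw [hy, hw, heφ, hφe]
        have hgh : g = h := hinj (by rw [← hcancel g, ← hcancel h, hxy])
        rw [hgh]
    · intro w
      by_cases hw : w = z
      · exact ⟨none, hw.symm⟩
      obtain ⟨s, t, rfl⟩ := hsimple e hez w
      obtain ⟨i, g, hi⟩ := hr (s * e) (fun h => hw (by rw [h, (hz t).1]))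
        (by rw [mul_assoc, hee])
      obtain ⟨l, h, hl⟩ := hq (e * t)
        (fun h => hw (by rw [mul_assoc, h, (hz s).2])) (by rw [← mul_assoc, hee])
      refine ⟨some (i, g * h, l), ?_⟩
      calc r i * φ (g * h) * q l = (r i * φ g) * (φ h * q l) := by
            rw [map_mul]; simp only [mul_assoc]
        _ = s * (e * e) * t := by rw [← hi, ← hl]; simp only [mul_assoc]
        _ = s * e * t := by rw [hee]
  obtain ⟨i₀, -⟩ := hr e hez hee
  obtain ⟨l₀, -⟩ := hq e hez hee
  refine ⟨G, I, Λ, hG, hI, ⟨i₀⟩, hΛ, ⟨l₀⟩, P, fun l => ?_, fun i => ?_,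
    (Equiv.ofBijective _ hbij).symm, fun x y => ?_⟩
  · obtain ⟨w, hwe, hw⟩ := hq_inv l
    obtain ⟨i, g, rfl⟩ := hr w (fun h => hez (by rw [← hw, h, (hz _).2])) hwe
    refine ⟨i, hP_ne l i fun h => hez ?_⟩
    rw [← hw, ← mul_assoc, h, (hz _).1]
  · obtain ⟨y, hey, hy⟩ := hr_inv i
    obtain ⟨l, g, rfl⟩ := hq y (fun h => hez (by rw [← hy, h, (hz _).1])) hey
    refine ⟨l, hP_ne l i fun h => hez ?_⟩
    rw [← hy, mul_assoc, h, (hz _).2]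
  · rw [Equiv.symm_apply_eq, Equiv.ofBijective_apply, reesMap_reesMul hz hP]
    simp only [Equiv.ofBijective_apply_symm_apply]
end
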